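/- arXiv:1507.06095 — 2 statements merged into one kernel-verified Lean document; each statement's English description precedes it below -/
import Mathlib

section
/- Define a : [0,∞) → ℝ by a(1) = 1 and a(t) = (1 + t − 2e^{t−1})/(1 − t) for t ≠ 1. Then v₀(t) = 2e^{−1} − (1 + t)e^{−t} is a C² solution of the dual equation v'' + (1/a(t))·v = 0 on [0,∞), v₀(1) = 0, v₀(t) > 0 for t > 1, and ∫₂^∞ dt/v₀(t)² = ∞ (so v₀ is a principal solution of the dual equation). -/
open Set Filter MeasureTheory Topology Real

/-- `x` (with derivative `x'`) is a solution of `(a(t) x')' + c(t) F(x) = 0` on `I`: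
`x` is `C¹` on `I`, `t ↦ a t * x' t` is `C¹` on `I`, and the equation holds on `I`. -/
def SolODE (a c F : ℝ → ℝ) (I : Set ℝ) (x x' : ℝ → ℝ) : Prop :=
  (∀ t ∈ I, HasDerivWithinAt x (x' t) I t) ∧ ContinuousOn x' I ∧
  ∃ w : ℝ → ℝ, (∀ t ∈ I, HasDerivWithinAt (fun s => a s * x' s) (w t) I t) ∧
    ContinuousOn w I ∧ ∀ t ∈ I, w t + c t * F (x t) = 0

/-- `z` (with derivatives `z'`, `z''`) is a `C²` solution of `z'' + c(t) F(z) = 0` on `I`. -/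
def SolODE2 (c F : ℝ → ℝ) (I : Set ℝ) (z z' z'' : ℝ → ℝ) : Prop :=
  (∀ t ∈ I, HasDerivWithinAt z (z' t) I t) ∧ (∀ t ∈ I, HasDerivWithinAt z' (z'' t) I t) ∧
  ContinuousOn z'' I ∧ ∀ t ∈ I, z'' t + c t * F (z t) = 0

/-- The linear equation `(a(t) y')' + β(t) y = 0` is disconjugate on `I`:
every nontrivial solution has at most one zero in `I`. -/
def Disconjugate (a β : ℝ → ℝ) (I : Set ℝ) : Prop :=
  ∀ y y' : ℝ → ℝ, SolODE a β id I y y' → (∃ t ∈ I, y t ≠ 0) →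
    ∀ t₁ ∈ I, ∀ t₂ ∈ I, y t₁ = 0 → y t₂ = 0 → t₁ = t₂

/-- The linear equation `v'' + β(t) v = 0` is disconjugate on `I`:
every nontrivial solution has at most one zero in `I`. -/
def Disconjugate2 (β : ℝ → ℝ) (I : Set ℝ) : Prop :=
  ∀ v v' v'' : ℝ → ℝ, SolODE2 β id I v v' v'' → (∃ t ∈ I, v t ≠ 0) →
    ∀ t₁ ∈ I, ∀ t₂ ∈ I, v t₁ = 0 → v t₂ = 0 → t₁ = t₂

/-- The coefficient of Example 1. -/
noncomputable def aEx (t : ℝ) : ℝ :=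
  if t = 1 then 1 else (1 + t - 2 * Real.exp (t - 1)) / (1 - t)

/-- The derivative of `c - (1 + t) e^{-t}` is `t e^{-t}`. -/
theorem hasDerivAt_const_sub_one_add_mul_exp_neg (c t : ℝ) :
    HasDerivAt (fun t : ℝ => c - (1 + t) * Real.exp (-t)) (t * Real.exp (-t)) t := by
  refine ((((hasDerivAt_id' t).const_add 1).mul (hasDerivAt_neg t).exp).const_sub c).congr_deriv ?_
  ring

theorem hasDerivAt_mul_exp_neg (t : ℝ) :
    HasDerivAt (fun t : ℝ => t * Real.exp (-t)) ((1 - t) * Real.exp (-t)) t := by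
  refine ((hasDerivAt_id' t).mul (hasDerivAt_neg t).exp).congr_deriv ?_
  ring

theorem strictMonoOn_const_sub_one_add_mul_exp_neg (c : ℝ) :
    StrictMonoOn (fun t : ℝ => c - (1 + t) * Real.exp (-t)) (Ici 0) := by
  refine strictMonoOn_of_deriv_pos (convex_Ici 0) (by fun_prop) fun t ht => ?_
  rw [interior_Ici, mem_Ioi] at ht
  rw [(hasDerivAt_const_sub_one_add_mul_exp_neg c t).deriv]
  positivity

/-- Remark 2: `v₀(t) = 2e^{-1} - (1+t)e^{-t}` is a `C²` solution of the dual equation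
`v'' + (1/a(t))v = 0` on `[0,∞)`, with `v₀(1) = 0`, `v₀ > 0` on `(1,∞)`, and
`∫₂^∞ dt/v₀² = ∞` (so `v₀` is a principal solution of the dual equation). -/
theorem example_one_dual :
    (∃ v₀' v₀'' : ℝ → ℝ, SolODE2 (fun t => 1 / aEx t) id (Ici 0)
      (fun t => 2 * Real.exp (-1) - (1 + t) * Real.exp (-t)) v₀' v₀'') ∧
    (2 * Real.exp (-1) - (1 + (1:ℝ)) * Real.exp (-(1:ℝ)) = 0) ∧
    (∀ t : ℝ, 1 < t → 0 < 2 * Real.exp (-1) - (1 + t) * Real.exp (-t)) ∧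
    ¬ IntegrableOn
      (fun t => 1 / (2 * Real.exp (-1) - (1 + t) * Real.exp (-t)) ^ 2) (Ici 2) := by
  have hmono := strictMonoOn_const_sub_one_add_mul_exp_neg (2 * Real.exp (-1))
  have hone : 2 * Real.exp (-1) - (1 + (1 : ℝ)) * Real.exp (-(1 : ℝ)) = 0 := by ring
  have hpos : ∀ t : ℝ, 1 < t → 0 < 2 * Real.exp (-1) - (1 + t) * Real.exp (-t) := fun t ht => by
    have h := hmono (mem_Ici.2 zero_le_one) (mem_Ici.2 (zero_le_one.trans ht.le)) ht
    simpa only [hone] using h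
  refine ⟨⟨fun t => t * Real.exp (-t), fun t => (1 - t) * Real.exp (-t),
    fun t _ => (hasDerivAt_const_sub_one_add_mul_exp_neg _ t).hasDerivWithinAt,
    fun t _ => (hasDerivAt_mul_exp_neg t).hasDerivWithinAt, by fun_prop, fun t ht => ?_⟩,
    hone, hpos, fun hint => ?_⟩
  · by_cases h1 : t = 1
    · subst h1
      simp only [id, hone]
      ring
    · have hv : 2 * Real.exp (-1) - (1 + t) * Real.exp (-t) ≠ 0 := fun h =>
        h1 (hmono.injOn ht (mem_Ici.2 zero_le_one) (h.trans hone.symm))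
      have hfac : 2 * Real.exp (-1) - (1 + t) * Real.exp (-t) =
          -(1 + t - 2 * Real.exp (t - 1)) * Real.exp (-t) := by
        have : Real.exp (-1) = Real.exp (t - 1) * Real.exp (-t) := by
          rw [← Real.exp_add]
          ring_nf
        rw [this]
        ring
      have hden : 1 + t - 2 * Real.exp (t - 1) ≠ 0 := fun h => hv (by rw [hfac, h]; simp)
      simp only [id, aEx, if_neg h1, hfac, one_div_div]
      field_simp
      ring
  · have hbound : IntegrableOn (fun _ : ℝ => (1 : ℝ)) (Ici 2) := by
      refine Integrable.mono' hint aestronglyMeasurable_const ?_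
      refine (ae_restrict_mem measurableSet_Ici).mono fun t ht => ?_
      rw [mem_Ici] at ht
      have hv := hpos t (by linarith)
      have he : 2 * Real.exp (-1) ≤ 1 := by
        have h2 := Real.add_one_le_exp 1
        rw [Real.exp_neg, ← div_eq_mul_inv, div_le_one (Real.exp_pos 1)]
        linarith
      have hle : 2 * Real.exp (-1) - (1 + t) * Real.exp (-t) ≤ 1 := by
        have : 0 ≤ (1 + t) * Real.exp (-t) := by positivity
        linarith
      rw [norm_one, le_div_iff₀ (by positivity), one_mul]
      exact pow_le_one₀ hv.le hle
    simp [integrableOn_const_iff] at hbound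
end

section
/- Let a : [0,∞) → ℝ be continuous and positive and b : [0,∞) → ℝ continuous. If the linear equation (a(t)x')' + b(t)x = 0 has a solution x satisfying x(0) = 0, x(t) > 0 for all t ∈ (0,∞), and lim_{t→∞} x(t) = 0, then the equation (a(t)x')' + b(t)x = 0 is disconjugate on [0,∞). -/
open Set Filter MeasureTheory Topology Real

/-- A function on a convex set of reals whose derivative vanishes there is constant. -/
theorem eq_of_hasDerivWithinAt_zero {f : ℝ → ℝ} {s : Set ℝ} (hs : Convex ℝ s)
    (hf : ∀ t ∈ s, HasDerivWithinAt f 0 s t) {u v : ℝ} (hu : u ∈ s) (hv : v ∈ s) : f u = f v := by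
  have h := hs.norm_image_sub_le_of_norm_hasDerivWithin_le (C := 0) hf (by simp) hv hu
  rw [zero_mul] at h
  exact sub_eq_zero.mp (norm_le_zero_iff.mp h)

/-- The Wronskian of two solutions of a linear equation is constant (Abel's identity). -/
theorem SolODE.wronskian_eq {a b x x' y y' : ℝ → ℝ} {s : Set ℝ} (hs : Convex ℝ s)
    (hx : SolODE a b id s x x') (hy : SolODE a b id s y y') {u v : ℝ} (hu : u ∈ s) (hv : v ∈ s) :
    x u * (a u * y' u) - a u * x' u * y u = x v * (a v * y' v) - a v * x' v * y v := by
  obtain ⟨hx₁, -, wx, hwx, -, hxe⟩ := hx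
  obtain ⟨hy₁, -, wy, hwy, -, hye⟩ := hy
  refine eq_of_hasDerivWithinAt_zero (f := fun t => x t * (a t * y' t) - a t * x' t * y t)
    hs (fun t ht => ?_) hu hv
  refine (((hx₁ t ht).mul (hwy t ht)).sub ((hwx t ht).mul (hy₁ t ht))).congr_deriv ?_
  have h₁ := hxe t ht
  have h₂ := hye t ht
  simp only [id] at h₁ h₂
  linear_combination x t * h₂ - y t * h₁

/-- The derivative of the quotient of two solutions at an interior point, in terms of their
Wronskian. -/
theorem SolODE.hasDerivAt_div {a b x x' y y' : ℝ → ℝ} {s : Set ℝ} {t : ℝ}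
    (hx : SolODE a b id s x x') (hy : SolODE a b id s y y') (ht : s ∈ 𝓝 t)
    (ha : a t ≠ 0) (hxt : x t ≠ 0) :
    HasDerivAt (fun r => y r / x r)
      ((x t * (a t * y' t) - a t * x' t * y t) / (a t * x t ^ 2)) t := by
  have hts := mem_of_mem_nhds ht
  refine (((hy.1 t hts).hasDerivAt ht).div ((hx.1 t hts).hasDerivAt ht) hxt).congr_deriv ?_
  field_simp

/-- An equation with a solution that vanishes at `0` and is positive on `(0,∞)` is disconjugate
on `[0,∞)`. -/
theorem disconjugate_of_pos_solution {a b x x' : ℝ → ℝ} (ha_pos : ∀ t ∈ Ici (0:ℝ), 0 < a t)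
    (hsol : SolODE a b id (Ici 0) x x') (hx0 : x 0 = 0) (hx_pos : ∀ t : ℝ, 0 < t → 0 < x t) :
    Disconjugate a b (Ici 0) := by
  rintro y y' hy ⟨t₀, ht₀, hyt₀⟩
  set c := x 0 * (a 0 * y' 0) - a 0 * x' 0 * y 0 with hc
  have hq : ∀ t : ℝ, 0 < t → HasDerivAt (fun r => y r / x r) (c / (a t * x t ^ 2)) t := by
    intro t ht
    have h := hsol.hasDerivAt_div hy (Ici_mem_nhds ht) (ha_pos t ht.le).ne' (hx_pos t ht).ne'
    rwa [hsol.wronskian_eq (convex_Ici 0) hy (v := 0) ht.le self_mem_Ici] at h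
  have key : ∀ t₁ t₂ : ℝ, 0 ≤ t₁ → t₁ < t₂ → y t₁ = 0 → y t₂ = 0 → False := by
    intro t₁ t₂ h₁ h₁₂ hy₁ hy₂
    have h₂ : 0 < t₂ := h₁.trans_lt h₁₂
    have hc0 : c = 0 := by
      rcases h₁.eq_or_lt with rfl | h₁
      · simp [hc, hx0, hy₁]
      · obtain ⟨t, ht, h⟩ := exists_hasDerivAt_eq_zero h₁₂
          (fun t ht => (hq t (h₁.trans_le ht.1)).continuousAt.continuousWithinAt)
          (by simp [hy₁, hy₂]) (fun t ht => hq t (h₁.trans ht.1))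
        have htpos : 0 < t := h₁.trans ht.1
        have : a t * x t ^ 2 ≠ 0 :=
          (mul_pos (ha_pos t htpos.le) (pow_pos (hx_pos t htpos) 2)).ne'
        exact (div_eq_zero_iff.mp h).resolve_right this
    have hy_zero : ∀ t ∈ Ioi (0:ℝ), y t = 0 := by
      intro t ht
      have h := eq_of_hasDerivWithinAt_zero (convex_Ioi 0)
        (fun r hr => by simpa [hc0] using (hq r hr).hasDerivWithinAt) ht (mem_Ioi.mpr h₂)
      simp only [hy₂, zero_div] at h
      exact (div_eq_zero_iff.mp h).resolve_right (hx_pos t ht).ne'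
    refine hyt₀ ?_
    rcases (mem_Ici.mp ht₀).eq_or_lt with rfl | ht
    · have h : Tendsto y (𝓝[>] 0) (𝓝 (y 0)) :=
        (hy.1 0 ht₀).continuousWithinAt.mono Ioi_subset_Ici_self
      exact tendsto_nhds_unique h (tendsto_const_nhds.congr'
        (eventually_mem_nhdsWithin.mono fun t ht => (hy_zero t ht).symm))
    · exact hy_zero t₀ ht
  intro t₁ h₁ t₂ h₂ hy₁ hy₂
  rcases lt_trichotomy t₁ t₂ with h | h | h
  · exact (key t₁ t₂ h₁ h hy₁ hy₂).elim
  · exact h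
  · exact (key t₂ t₁ h₂ h hy₂ hy₁).elim

/-- Remark 6: if the linear equation `(a x')' + b x = 0` has a solution with `x(0) = 0`,
`x > 0` on `(0,∞)` and `x(∞) = 0`, then the equation is disconjugate on `[0,∞)`. -/
theorem disconjugate_of_dirichlet_solution
    (a b : ℝ → ℝ)
    (ha_cont : ContinuousOn a (Ici 0)) (ha_pos : ∀ t ∈ Ici (0:ℝ), 0 < a t)
    (hb_cont : ContinuousOn b (Ici 0))
    (x x' : ℝ → ℝ) (hsol : SolODE a b id (Ici 0) x x')
    (hx0 : x 0 = 0) (hx_pos : ∀ t : ℝ, 0 < t → 0 < x t)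
    (hx_lim : Tendsto x atTop (𝓝 0)) :
    Disconjugate a b (Ici 0) :=
  disconjugate_of_pos_solution ha_pos hsol hx0 hx_pos
end
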